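/- arXiv:2501.06889 — 2 statements merged into one kernel-verified Lean document; each statement's English description precedes it below -/
import Mathlib

section
/- For every integer a ≥ 7 for which the ring of integers of the simplest cubic field K_a equals ℤ[ρ], the regulator Reg_{K_a} of K_a satisfies (log a)² ≤ Reg_{K_a} ≤ (3/2)·(log a)². -/
open NumberField

/-- The largest real root of `X³ - aX² - (a+3)X - 1` (for `a ≥ 7` this set of real roots
is nonempty and bounded above, so `sSup` picks out the largest root). -/
noncomputable def simplestCubicRoot (a : ℤ) : ℝ :=
  sSup {x : ℝ | x ^ 3 - (a : ℝ) * x ^ 2 - ((a : ℝ) + 3) * x - 1 = 0}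

theorem simplestCubicRoot_spec {a : ℤ} (ha : 7 ≤ a) :
    simplestCubicRoot a ^ 3 - (a : ℝ) * simplestCubicRoot a ^ 2
        - ((a : ℝ) + 3) * simplestCubicRoot a - 1 = 0 ∧
      (a : ℝ) + 1 < simplestCubicRoot a ∧ simplestCubicRoot a < (a : ℝ) + 2 := by
  have ha' : (7 : ℝ) ≤ a := by exact_mod_cast ha
  set S : Set ℝ := {x : ℝ | x ^ 3 - (a : ℝ) * x ^ 2 - ((a : ℝ) + 3) * x - 1 = 0} with hS
  have upper : ∀ x ∈ S, x < (a : ℝ) + 2 := by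
    intro x hx
    by_contra! h
    obtain ⟨d, rfl⟩ : ∃ d, x = a + 2 + d := ⟨x - (a + 2), by ring⟩
    have hd : 0 ≤ d := by linarith
    have hx : (a + 2 + d) ^ 3 - (a : ℝ) * (a + 2 + d) ^ 2 - ((a : ℝ) + 3) * (a + 2 + d) - 1 = 0 :=
      hx
    have : (0 : ℝ) ≤ d ^ 3 + d ^ 2 * (2 * a + 6) + d * (a ^ 2 + 7 * a + 9) := by positivity
    nlinarith
  obtain ⟨x, hx, hx0⟩ : ∃ x ∈ Set.Icc ((a : ℝ) + 1) (a + 2),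
      x ^ 3 - (a : ℝ) * x ^ 2 - ((a : ℝ) + 3) * x - 1 = 0 := by
    apply intermediate_value_Icc (by linarith) (by fun_prop)
    constructor <;> nlinarith
  have hx1 : (a : ℝ) + 1 < x := by
    rcases hx.1.eq_or_lt with h | h
    · rw [← h] at hx0
      nlinarith
    · exact h
  have hbdd : BddAbove S := ⟨a + 2, fun x hx ↦ (upper x hx).le⟩
  have hmem : simplestCubicRoot a ∈ S :=
    (isClosed_eq (by fun_prop) (by fun_prop)).csSup_mem ⟨x, hx0⟩ hbdd
  exact ⟨hmem, hx1.trans_le (le_csSup hbdd hx0), upper _ hmem⟩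

theorem even_of_simplestCubicForm_eq_zero {a m n : ℤ}
    (h : m ^ 3 - a * m ^ 2 * n - (a + 3) * m * n ^ 2 - n ^ 3 = 0) : Even m ∧ Even n := by
  have key : ∀ x y z : ZMod 2,
      y ^ 3 - x * y ^ 2 * z - (x + 3) * y * z ^ 2 - z ^ 3 = 0 → y = 0 ∧ z = 0 := by decide
  have h2 := congrArg (Int.cast : ℤ → ZMod 2) h
  push_cast at h2
  simpa only [ZMod.intCast_eq_zero_iff_even] using key _ _ _ h2

theorem simplestCubicForm_eq_zero {a m n : ℤ}
    (h : m ^ 3 - a * m ^ 2 * n - (a + 3) * m * n ^ 2 - n ^ 3 = 0) : m = 0 ∧ n = 0 := by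
  by_contra hmn
  induction hk : m.natAbs + n.natAbs using Nat.strong_induction_on generalizing m n with
  | _ k ih =>
    obtain ⟨⟨x, rfl⟩, ⟨y, rfl⟩⟩ := even_of_simplestCubicForm_eq_zero h
    have h' : x ^ 3 - a * x ^ 2 * y - (a + 3) * x * y ^ 2 - y ^ 3 = 0 := by
      linarith [show (x + x) ^ 3 - a * (x + x) ^ 2 * (y + y) - (a + 3) * (x + x) * (y + y) ^ 2
        - (y + y) ^ 3 = 8 * (x ^ 3 - a * x ^ 2 * y - (a + 3) * x * y ^ 2 - y ^ 3) by ring]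
    have hxy : ¬(x = 0 ∧ y = 0) := by omega
    exact ih _ (by omega) h' hxy rfl

theorem one_sub_mul_one_sub_mul_one_sub_mul_le_two {s t : ℝ} (hs : |s| ≤ 1) (ht : |t| ≤ 1) :
    (1 - s) * (1 - t) * (1 - s * t) ≤ 2 := by
  obtain ⟨hs1, hs2⟩ := abs_le.mp hs
  obtain ⟨ht1, ht2⟩ := abs_le.mp ht
  have aux : ∀ x y : ℝ, -1 ≤ x → x ≤ 0 → 0 ≤ y → y ≤ 1 → (1 - x) * (1 - y) * (1 - x * y) ≤ 2 := by
    intro x y hx hx0 hy0 hy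
    have h1 : (1 - y) * (1 - x * y) ≤ 1 := by
      nlinarith [mul_nonneg hy0 (by linarith : 0 ≤ 1 + x),
        mul_nonneg (mul_nonneg hy0 hy0) (neg_nonneg.mpr hx0)]
    nlinarith
  rcases le_total s 0 with hs0 | hs0 <;> rcases le_total t 0 with ht0 | ht0
  · have hp : 0 ≤ s * t := mul_nonneg_of_nonpos_of_nonpos hs0 ht0
    have h1 : (1 - s) * (1 - t) ≤ 2 * (1 + s * t) := by nlinarith
    have h2 : 0 ≤ 1 - s * t := by nlinarith
    nlinarith [mul_le_mul_of_nonneg_right h1 h2]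
  · exact aux s t hs1 hs0 ht0 ht2
  · have := aux t s ht1 ht0 hs0 hs2
    nlinarith
  · have h1 : (1 - s) * (1 - t) ≤ 1 := by nlinarith
    have h2 : 0 ≤ (1 - s) * (1 - t) := mul_nonneg (by linarith) (by linarith)
    have h3 : 0 ≤ s * t := mul_nonneg hs0 ht0
    nlinarith

theorem abs_sub_mul_sub_mul_sub_le_of_abs_le {x y z : ℝ} (hz : z ≠ 0) (hzy : |z| ≤ |y|)
    (hyx : |y| ≤ |x|) : |(x - y) * (y - z) * (z - x)| ≤ 2 * (|x| ^ 2 * |y|) := by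
  have hy : y ≠ 0 := abs_pos.mp ((abs_pos.mpr hz).trans_le hzy)
  have hx : x ≠ 0 := abs_pos.mp ((abs_pos.mpr hy).trans_le hyx)
  have hs : |y / x| ≤ 1 := by rw [abs_div]; exact div_le_one_of_le₀ hyx (abs_nonneg _)
  have ht : |z / y| ≤ 1 := by rw [abs_div]; exact div_le_one_of_le₀ hzy (abs_nonneg _)
  have hst : |y / x * (z / y)| ≤ 1 := by
    rw [abs_mul]; exact mul_le_one₀ hs (abs_nonneg _) ht
  have e : (x - y) * (y - z) * (z - x)
      = -((1 - y / x) * (1 - z / y) * (1 - y / x * (z / y)) * (x ^ 2 * y)) := by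
    field_simp
    ring
  have hnn : 0 ≤ (1 - y / x) * (1 - z / y) * (1 - y / x * (z / y)) :=
    mul_nonneg (mul_nonneg (by linarith [(abs_le.mp hs).2]) (by linarith [(abs_le.mp ht).2]))
      (by linarith [(abs_le.mp hst).2])
  rw [e, abs_neg, abs_mul, abs_of_nonneg hnn, abs_mul, abs_pow]
  exact mul_le_mul_of_nonneg_right (one_sub_mul_one_sub_mul_one_sub_mul_le_two hs ht)
    (by positivity)

theorem abs_sub_mul_sub_mul_sub_le {x y z C : ℝ} (h : |x * y * z| = 1)
    (hxy : |x| ≤ C * |y|) (hyx : |y| ≤ C * |x|) (hyz : |y| ≤ C * |z|) (hzy : |z| ≤ C * |y|)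
    (hzx : |z| ≤ C * |x|) (hxz : |x| ≤ C * |z|) :
    |(x - y) * (y - z) * (z - x)| ≤ 2 * C := by
  have ordered : ∀ x y z : ℝ, |x * y * z| = 1 → |z| ≤ |y| → |y| ≤ |x| → |x| ≤ C * |z| →
      |(x - y) * (y - z) * (z - x)| ≤ 2 * C := by
    intro x y z h hzy hyx hxz
    have hz : z ≠ 0 := by rintro rfl; simp at h
    refine (abs_sub_mul_sub_mul_sub_le_of_abs_le hz hzy hyx).trans ?_
    rw [abs_mul, abs_mul] at h
    have := mul_le_mul_of_nonneg_right hxz (by positivity : 0 ≤ |x| * |y|)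
    linarith [show C * |z| * (|x| * |y|) = C by linear_combination C * h]
  have n1 : (x - z) * (z - y) * (y - x) = -((x - y) * (y - z) * (z - x)) := by ring
  have n2 : (y - x) * (x - z) * (z - y) = -((x - y) * (y - z) * (z - x)) := by ring
  have n3 : (z - y) * (y - x) * (x - z) = -((x - y) * (y - z) * (z - x)) := by ring
  have p1 : (y - z) * (z - x) * (x - y) = (x - y) * (y - z) * (z - x) := by ring
  have p2 : (z - x) * (x - y) * (y - z) = (x - y) * (y - z) * (z - x) := by ring
  have q1 : |x * z * y| = 1 := by rw [← h]; congr 1; ring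
  have q2 : |y * x * z| = 1 := by rw [← h]; congr 1; ring
  have q3 : |z * y * x| = 1 := by rw [← h]; congr 1; ring
  have q4 : |y * z * x| = 1 := by rw [← h]; congr 1; ring
  have q5 : |z * x * y| = 1 := by rw [← h]; congr 1; ring
  rcases le_total |x| |y| with h1 | h1 <;> rcases le_total |y| |z| with h2 | h2 <;>
    rcases le_total |z| |x| with h3 | h3
  · simpa [n3] using ordered z y x q3 h1 h2 hzx
  · simpa [n3] using ordered z y x q3 h1 h2 hzx
  · simpa [n2] using ordered y x z q2 h3 h1 hyz
  · simpa [p1] using ordered y z x q4 h3 h2 hyx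
  · simpa [n1] using ordered x z y q1 h2 h3 hxy
  · simpa [p2] using ordered z x y q5 h1 h3 hzy
  · exact ordered x y z h h2 h1 hxz
  · exact ordered x y z h h2 h1 hxz

theorem simplestCubic_differences {a r : ℝ} (hr : 0 < r)
    (h : r ^ 3 - a * r ^ 2 - (a + 3) * r - 1 = 0) :
    (r - -(1 + r) / r) * (-(1 + r) / r - -1 / (1 + r)) * (-1 / (1 + r) - r)
      = a ^ 2 + 3 * a + 9 := by
  have ha : a = (r ^ 3 - 3 * r - 1) / (r ^ 2 + r) := by
    rw [eq_div_iff (by positivity)]; linarith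
  rw [ha]
  field_simp
  ring

theorem simplestCubic_form_eq {a r : ℝ} (hr : 0 < r)
    (h : r ^ 3 - a * r ^ 2 - (a + 3) * r - 1 = 0) (m n : ℝ) :
    (m - n * r) * (m - n * (-(1 + r) / r)) * (m - n * (-1 / (1 + r)))
      = m ^ 3 - a * m ^ 2 * n - (a + 3) * m * n ^ 2 - n ^ 3 := by
  have ha : a = (r ^ 3 - 3 * r - 1) / (r ^ 2 + r) := by
    rw [eq_div_iff (by positivity)]; linarith
  rw [ha]
  field_simp
  ring

theorem simplestCubic_eq_zero_of_conjugates_close {a : ℤ} (ha : 7 ≤ a) {r : ℝ}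
    (h : r ^ 3 - (a : ℝ) * r ^ 2 - (a + 3) * r - 1 = 0) (hr1 : (a : ℝ) + 1 < r)
    (hr2 : r < (a : ℝ) + 2) {C : ℝ} (hC : C ^ 2 ≤ (1 + r) ^ 3)
    (p q s : ℤ) {x y z : ℝ} (hx : x = p + q * r + s * r ^ 2)
    (hy : y = p + q * (-(1 + r) / r) + s * (-(1 + r) / r) ^ 2)
    (hz : z = p + q * (-1 / (1 + r)) + s * (-1 / (1 + r)) ^ 2) (hxyz : |x * y * z| = 1)
    (hxy : |x| ≤ C * |y|) (hyx : |y| ≤ C * |x|) (hyz : |y| ≤ C * |z|) (hzy : |z| ≤ C * |y|)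
    (hzx : |z| ≤ C * |x|) (hxz : |x| ≤ C * |z|) : q = 0 ∧ s = 0 := by
  have ha' : (7 : ℝ) ≤ a := by exact_mod_cast ha
  have hr : 0 < r := by linarith
  have hsum : r + -(1 + r) / r + -1 / (1 + r) = a := by
    have : (a : ℝ) = (r ^ 3 - 3 * r - 1) / (r ^ 2 + r) := by
      rw [eq_div_iff (by positivity)]; linarith
    rw [this]; field_simp; ring
  have hd := simplestCubic_differences hr h
  have hf := simplestCubic_form_eq hr h (q + s * a) s
  set r2 := -(1 + r) / r
  set r3 := -1 / (1 + r)
  have hprod : (x - y) * (y - z) * (z - x) = (a ^ 2 + 3 * a + 9) *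
      (((q + s * a) ^ 3 - a * (q + s * a) ^ 2 * s - (a + 3) * (q + s * a) * s ^ 2 - s ^ 3 : ℤ) :
        ℝ) := by
    push_cast
    rw [← hf, ← hd, hx, hy, hz, ← hsum]
    ring
  have hle := abs_sub_mul_sub_mul_sub_le hxyz hxy hyx hyz hzy hzx hxz
  have hF : (q + s * a) ^ 3 - a * (q + s * a) ^ 2 * s - (a + 3) * (q + s * a) * s ^ 2 - s ^ 3
      = 0 := by
    by_contra hne
    have h1 : (1 : ℝ) ≤ |(((q + s * a) ^ 3 - a * (q + s * a) ^ 2 * s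
        - (a + 3) * (q + s * a) * s ^ 2 - s ^ 3 : ℤ) : ℝ)| := by
      exact_mod_cast Int.one_le_abs hne
    have hpos : (0 : ℝ) < a ^ 2 + 3 * a + 9 := by positivity
    rw [hprod, abs_mul, abs_of_pos hpos] at hle
    have h2 : (a : ℝ) ^ 2 + 3 * a + 9 ≤ 2 * C := by nlinarith
    have h3 : ((a : ℝ) ^ 2 + 3 * a + 9) ^ 2 ≤ (2 * C) ^ 2 := by gcongr
    have h4 : (1 + r) ^ 3 ≤ ((a : ℝ) + 3) ^ 3 := pow_le_pow_left₀ (by linarith) (by linarith) 3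
    obtain ⟨b, hb, hab⟩ : ∃ b : ℝ, 0 ≤ b ∧ (a : ℝ) = b + 7 := ⟨a - 7, by linarith, by ring⟩
    rw [hab] at h3 h4
    have h5 : 0 ≤ b ^ 4 + 30 * b ^ 3 + 327 * b ^ 2 + 1486 * b := by positivity
    have h6 : ((b + 7) ^ 2 + 3 * (b + 7) + 9) ^ 2 - 4 * (b + 7 + 3) ^ 3
        = b ^ 4 + 30 * b ^ 3 + 327 * b ^ 2 + 1486 * b + 2241 := by ring
    linarith [mul_pow 2 C 2]
  obtain ⟨h1, h2⟩ := simplestCubicForm_eq_zero hF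
  subst h2
  simpa using h1

section Field

open Polynomial Module

variable {K : Type*} [Field K] [NumberField K]

theorem minpoly_of_simplestCubic {a : ℤ} {x : K}
    (hx : x ^ 3 - a * x ^ 2 - (a + 3) * x - 1 = 0) :
    minpoly ℚ x = X ^ 3 - C (a : ℚ) * X ^ 2 - C ((a : ℚ) + 3) * X - 1 := by
  have hdeg : (X ^ 3 - C (a : ℚ) * X ^ 2 - C ((a : ℚ) + 3) * X - 1).natDegree = 3 := by
    compute_degree!
  have hmonic : (X ^ 3 - C (a : ℚ) * X ^ 2 - C ((a : ℚ) + 3) * X - 1).Monic := by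
    monicity!
  refine (minpoly.eq_of_irreducible_of_monic ?_ ?_ hmonic).symm
  · refine irreducible_of_degree_le_three_of_not_isRoot (by rw [hdeg]; decide) fun y hy ↦ ?_
    have hy' : y ^ 3 - a * y ^ 2 - (a + 3) * y - 1 = 0 := by simpa using hy
    have hden : (y.den : ℚ) ≠ 0 := by exact_mod_cast y.den_ne_zero
    have hform : y.num ^ 3 - a * y.num ^ 2 * (y.den : ℤ) - (a + 3) * y.num * (y.den : ℤ) ^ 2
        - (y.den : ℤ) ^ 3 = 0 := by
      have hnum : (y.num : ℚ) = y * y.den := (Rat.mul_den_eq_num y).symm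
      have : (y.num : ℚ) ^ 3 - a * y.num ^ 2 * y.den - (a + 3) * y.num * y.den ^ 2
          - (y.den : ℚ) ^ 3 = 0 := by
        rw [hnum]
        linear_combination (y.den : ℚ) ^ 3 * hy'
      exact_mod_cast this
    have := (simplestCubicForm_eq_zero hform).2
    exact y.den_ne_zero (by exact_mod_cast this)
  · simpa using hx

theorem exists_embedding_of_simplestCubic {a : ℤ} {x : K}
    (hx : x ^ 3 - a * x ^ 2 - (a + 3) * x - 1 = 0) {c : ℂ}
    (hc : c ^ 3 - a * c ^ 2 - (a + 3) * c - 1 = 0) : ∃ φ : K →+* ℂ, φ x = c := by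
  have hmem : c ∈ (minpoly ℚ x).rootSet ℂ := by
    rw [mem_rootSet]
    refine ⟨minpoly.ne_zero (Algebra.IsIntegral.isIntegral x), ?_⟩
    rw [minpoly_of_simplestCubic hx]
    simpa using hc
  rwa [← Embeddings.range_eval_eq_rootSet_minpoly K ℂ x] at hmem

theorem ringHom_ext_of_adjoin_eq_top {x : K} (hx : IntermediateField.adjoin ℚ {x} = ⊤)
    {φ ψ : K →+* ℂ} (h : φ x = ψ x) : φ = ψ := by
  ext y
  have hy : y ∈ IntermediateField.adjoin ℚ {x} := hx ▸ IntermediateField.mem_top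
  induction hy using IntermediateField.adjoin_induction with
  | mem z hz => rwa [Set.mem_singleton_iff.mp hz]
  | algebraMap q => simp
  | add z w _ _ hz hw => rw [map_add, map_add, hz, hw]
  | inv z _ hz => rw [map_inv₀, map_inv₀, hz]
  | mul z w _ _ hz hw => rw [map_mul, map_mul, hz, hw]

theorem simplestCubic_factorization {F : Type*} [Field F] {a r x : F} (hr : r ≠ 0) (hr' : 1 + r ≠ 0)
    (h : r ^ 3 - a * r ^ 2 - (a + 3) * r - 1 = 0) :
    x ^ 3 - a * x ^ 2 - (a + 3) * x - 1 =
      (x - r) * (x - -(1 + r) / r) * (x - -1 / (1 + r)) := by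
  have ha : a = (r ^ 3 - 3 * r - 1) / (r * (1 + r)) := by
    rw [eq_div_iff (mul_ne_zero hr hr')]; linear_combination -h
  rw [ha]
  field_simp
  ring

theorem exists_infinitePlace_equiv {a : ℤ} {x : K}
    (hx : x ^ 3 - a * x ^ 2 - (a + 3) * x - 1 = 0) (hadj : IntermediateField.adjoin ℚ {x} = ⊤)
    {r : ℝ} (h : r ^ 3 - (a : ℝ) * r ^ 2 - (a + 3) * r - 1 = 0)
    (hr2 : 2 < r) :
    ∃ W : Fin 3 ≃ InfinitePlace K, (∀ i, (W i).mult = 1) ∧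
      ∀ i (p q s : ℤ), W i (p + q * x + s * x ^ 2) =
        |p + q * (![r, -(1 + r) / r, -1 / (1 + r)] i) +
          s * (![r, -(1 + r) / r, -1 / (1 + r)] i) ^ 2| := by
  have hr0 : r ≠ 0 := by positivity
  have hr1 : 1 + r ≠ 0 := by positivity
  set R : Fin 3 → ℝ := ![r, -(1 + r) / r, -1 / (1 + r)] with hR
  have hroot : ∀ i, ((R i : ℝ) : ℂ) ^ 3 - a * (R i : ℂ) ^ 2 - (a + 3) * (R i : ℂ) - 1 = 0 := by
    intro i
    have : R i ^ 3 - (a : ℝ) * R i ^ 2 - (a + 3) * R i - 1 = 0 := by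
      rw [simplestCubic_factorization hr0 hr1 h]
      fin_cases i <;> simp [hR]
    exact_mod_cast this
  choose φ hφ using fun i ↦ exists_embedding_of_simplestCubic hx (hroot i)
  have habs : ∀ i, InfinitePlace.mk (φ i) x = |R i| := fun i ↦ by
    rw [InfinitePlace.apply, hφ, Complex.norm_real, Real.norm_eq_abs]
  have hinj : Function.Injective fun i ↦ InfinitePlace.mk (φ i) := by
    intro i j hij
    have hab : |R i| = |R j| := by
      rw [← habs, ← habs]
      exact congrArg (fun w : InfinitePlace K ↦ w x) hij
    have h0 : |r| = r := abs_of_pos (by linarith)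
    have h1 : |-(1 + r) / r| = 1 + 1 / r := by
      rw [abs_div, abs_neg, h0, abs_of_pos (by linarith)]; field_simp; ring
    have h2 : |-1 / (1 + r)| = 1 / (1 + r) := by
      rw [abs_div, abs_neg, abs_one, abs_of_pos (by linarith)]
    have h3 : 1 / r < 1 := by rw [div_lt_one] <;> linarith
    have h4 : 0 < 1 / r := by positivity
    have h5 : 1 / (1 + r) < 1 := by rw [div_lt_one] <;> linarith
    have habs' : ∀ i, |R i| = ![r, 1 + 1 / r, 1 / (1 + r)] i := by
      intro i
      fin_cases i
      exacts [h0, h1, h2]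
    rw [habs', habs'] at hab
    generalize 1 / r = s at *
    generalize 1 / (1 + r) = t at *
    fin_cases i <;> fin_cases j <;> simp at hab ⊢ <;> linarith
  have hsurj : Function.Surjective fun i ↦ InfinitePlace.mk (φ i) := by
    intro w
    have hw := congrArg w.embedding hx
    simp only [map_sub, map_mul, map_pow, map_add, map_intCast, map_one, map_zero,
      map_ofNat] at hw
    rw [simplestCubic_factorization (r := (r : ℂ)) (by exact_mod_cast hr0)
      (by exact_mod_cast hr1) (by exact_mod_cast h)] at hw
    have : ∃ i, w.embedding x = R i := by
      rcases mul_eq_zero.mp hw with hw | hw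
      · rcases mul_eq_zero.mp hw with hw | hw
        · exact ⟨0, by simpa [hR] using sub_eq_zero.mp hw⟩
        · exact ⟨1, by simpa [hR] using sub_eq_zero.mp hw⟩
      · exact ⟨2, by simpa [hR] using sub_eq_zero.mp hw⟩
    obtain ⟨i, hi⟩ := this
    refine ⟨i, ?_⟩
    rw [← w.mk_embedding, ← ringHom_ext_of_adjoin_eq_top hadj ((hφ i).trans hi.symm)]
  have hbij : Function.Bijective fun i ↦ InfinitePlace.mk (φ i) := ⟨hinj, hsurj⟩
  refine ⟨Equiv.ofBijective _ hbij, fun i ↦ ?_, fun i p q s ↦ ?_⟩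
  · apply InfinitePlace.IsReal.mult_eq_one
    rw [Equiv.ofBijective_apply, InfinitePlace.isReal_mk_iff, ComplexEmbedding.isReal_iff]
    refine ringHom_ext_of_adjoin_eq_top hadj ?_
    rw [ComplexEmbedding.conjugate_coe_eq, hφ, Complex.conj_ofReal]
  · rw [Equiv.ofBijective_apply, InfinitePlace.apply]
    simp only [map_add, map_mul, map_pow, map_intCast, hφ]
    rw [← Real.norm_eq_abs, ← Complex.norm_real]
    push_cast
    rfl

end Field

theorem exists_int_coeff_of_mem_adjoin {K : Type*} [Field K] {a : ℤ} {x y : K}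
    (hx : x ^ 3 - a * x ^ 2 - (a + 3) * x - 1 = 0) (hy : y ∈ Algebra.adjoin ℤ {x}) :
    ∃ p q s : ℤ, y = p + q * x + s * x ^ 2 := by
  induction hy using Algebra.adjoin_induction with
  | mem y hy => exact ⟨0, 1, 0, by simp [Set.mem_singleton_iff.mp hy]⟩
  | algebraMap n => exact ⟨n, 0, 0, by simp⟩
  | add y z _ _ hy hz =>
    obtain ⟨p, q, s, rfl⟩ := hy
    obtain ⟨p', q', s', rfl⟩ := hz
    exact ⟨p + p', q + q', s + s', by push_cast; ring⟩
  | mul y z _ _ hy hz =>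
    obtain ⟨p, q, s, rfl⟩ := hy
    obtain ⟨p', q', s', rfl⟩ := hz
    refine ⟨p * p' + (q * s' + s * q') + s * s' * a,
      p * q' + q * p' + (q * s' + s * q') * (a + 3) + s * s' * (a * (a + 3) + 1),
      p * s' + q * q' + s * p' + (q * s' + s * q') * a + s * s' * (a ^ 2 + a + 3), ?_⟩
    push_cast
    linear_combination ((q * s' + s * q' : K) + s * s' * (x + a)) * hx

theorem exists_int_sub_close {A B x y z : ℝ} (hA : 0 < A) (hAB : A ≤ B) (hBA : B ≤ 2 * A)
    (hsum : x + y + z = 0) :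
    ∃ m n : ℤ, ∀ x' y' z' : ℝ, x' = x - (m * A + n * B) → y' = y - (m * (B - A) - n * A) →
      z' = z - (-m * B + n * (A - B)) →
      |x' - y'| ≤ 3 / 2 * B ∧ |y' - z'| ≤ 3 / 2 * B ∧ |z' - x'| ≤ 3 / 2 * B := by
  have hΔ : A ^ 2 - A * B + B ^ 2 ≠ 0 := by nlinarith
  set Δ := A ^ 2 - A * B + B ^ 2 with hΔdef
  set s := (A * x + B * y) / Δ
  set t := ((B - A) * x - A * y) / Δ
  have hx : x = s * A + t * B := by
    simp only [s, t]; field_simp; rw [hΔdef]; ring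
  have hy : y = s * (B - A) - t * A := by
    simp only [s, t]; field_simp; rw [hΔdef]; ring
  have hz : z = -s * B + t * (A - B) := by linarith
  refine ⟨round s, round t, ?_⟩
  rintro _ _ _ rfl rfl rfl
  obtain ⟨hs1, hs2⟩ := abs_le.mp (abs_sub_round s)
  obtain ⟨ht1, ht2⟩ := abs_le.mp (abs_sub_round t)
  generalize (round s : ℝ) = m at *
  generalize (round t : ℝ) = n at *
  rw [hx, hy, hz]
  have b1 := mul_nonneg (by linarith : 0 ≤ 1 / 2 - (s - m)) (by linarith : 0 ≤ 2 * A - B)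
  have b2 := mul_nonneg (by linarith : 0 ≤ 1 / 2 + (s - m)) (by linarith : 0 ≤ 2 * A - B)
  have b3 := mul_nonneg (by linarith : 0 ≤ 1 / 2 - (s - m)) (by linarith : 0 ≤ 2 * B - A)
  have b4 := mul_nonneg (by linarith : 0 ≤ 1 / 2 + (s - m)) (by linarith : 0 ≤ 2 * B - A)
  have b5 := mul_nonneg (by linarith : 0 ≤ 1 / 2 - (s - m)) (by linarith : 0 ≤ A + B)
  have b6 := mul_nonneg (by linarith : 0 ≤ 1 / 2 + (s - m)) (by linarith : 0 ≤ A + B)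
  have c1 := mul_nonneg (by linarith : 0 ≤ 1 / 2 - (t - n)) (by linarith : 0 ≤ 2 * A - B)
  have c2 := mul_nonneg (by linarith : 0 ≤ 1 / 2 + (t - n)) (by linarith : 0 ≤ 2 * A - B)
  have c3 := mul_nonneg (by linarith : 0 ≤ 1 / 2 - (t - n)) (by linarith : 0 ≤ 2 * B - A)
  have c4 := mul_nonneg (by linarith : 0 ≤ 1 / 2 + (t - n)) (by linarith : 0 ≤ 2 * B - A)
  have c5 := mul_nonneg (by linarith : 0 ≤ 1 / 2 - (t - n)) (by linarith : 0 ≤ A + B)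
  have c6 := mul_nonneg (by linarith : 0 ≤ 1 / 2 + (t - n)) (by linarith : 0 ≤ A + B)
  refine ⟨abs_le.mpr ⟨?_, ?_⟩, abs_le.mpr ⟨?_, ?_⟩, abs_le.mpr ⟨?_, ?_⟩⟩ <;> linarith

theorem log_estimates {a r : ℝ} (ha : 7 ≤ a) (hr1 : a + 1 < r) (hr2 : r < a + 2) :
    Real.log a ^ 2 ≤ Real.log r ^ 2 - Real.log r * Real.log (1 + r) + Real.log (1 + r) ^ 2 ∧
      Real.log r ^ 2 - Real.log r * Real.log (1 + r) + Real.log (1 + r) ^ 2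
        ≤ 3 / 2 * Real.log a ^ 2 := by
  have h0 : 0 < Real.log a := Real.log_pos (by linarith)
  have h1 : Real.log a ≤ Real.log r := Real.log_le_log (by linarith) (by linarith)
  have h2 : Real.log r ≤ Real.log (1 + r) := Real.log_le_log (by linarith) (by linarith)
  have h3 : 5 * Real.log (1 + r) ≤ 6 * Real.log a := by
    have key : (1 + r) ^ 5 ≤ a ^ 6 := calc
      (1 + r) ^ 5 ≤ (10 / 7 * a) ^ 5 := pow_le_pow_left₀ (by linarith) (by linarith) 5
      _ = (10 / 7) ^ 5 * a ^ 5 := mul_pow ..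
      _ ≤ a * a ^ 5 := by gcongr; linarith
      _ = a ^ 6 := by ring
    have := Real.log_le_log (pow_pos (by linarith) 5) key
    rw [Real.log_pow, Real.log_pow] at this
    exact_mod_cast this
  constructor
  · nlinarith [sq_nonneg (Real.log (1 + r) - Real.log r)]
  · have h4 : Real.log (1 + r) ^ 2 ≤ (6 / 5 * Real.log a) ^ 2 :=
      pow_le_pow_left₀ (by linarith) (by linarith) 2
    nlinarith [mul_nonneg (h0.le.trans h1) (sub_nonneg.mpr h2)]

theorem le_exp_mul_of_abs_log_sub_le {x y c : ℝ} (hx : 0 < x) (hy : 0 < y)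
    (h : |Real.log x - Real.log y| ≤ c) : x ≤ Real.exp c * y ∧ y ≤ Real.exp c * x := by
  rw [abs_le] at h
  constructor
  · rw [← Real.log_le_log_iff hx (by positivity), Real.log_mul (by positivity) hy.ne',
      Real.log_exp]
    linarith
  · rw [← Real.log_le_log_iff hy (by positivity), Real.log_mul (by positivity) hx.ne',
      Real.log_exp]
    linarith

section Units

open NumberField.Units

variable {K : Type*} [Field K] [NumberField K]

theorem regOfFamily_eq_of_rank_eq_two (W : Fin 3 ≃ InfinitePlace K) (hW : ∀ i, (W i).mult = 1)
    (hrank : rank K = 2) (ε : Fin 2 → (𝓞 K)ˣ) :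
    regOfFamily (fun i ↦ ε (finCongr hrank i)) =
      |Real.log (W 0 (ε 0 : K)) * Real.log (W 1 (ε 1 : K)) -
        Real.log (W 1 (ε 0 : K)) * Real.log (W 0 (ε 1 : K))| := by
  classical
  let e₀ : Fin 2 ≃ {w : InfinitePlace K // w ≠ W 2} :=
    (finSuccAboveEquiv (2 : Fin 3)).trans (W.subtypeEquiv fun i ↦ by simp)
  have h0 : (e₀ 0 : InfinitePlace K) = W 0 := rfl
  have h1 : (e₀ 1 : InfinitePlace K) = W 1 := rfl
  rw [regOfFamily_eq_det _ (W 2) (e₀.symm.trans (finCongr hrank.symm)),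
    ← Matrix.det_submatrix_equiv_self e₀, Matrix.det_fin_two]
  simp only [Matrix.submatrix_apply, Matrix.of_apply, h0, h1, hW, Equiv.trans_apply,
    Equiv.symm_apply_apply, finCongr_apply, Fin.cast_cast, Fin.cast_eq_self, Nat.cast_one, one_mul]

theorem regulator_simplestCubic {a : ℤ} (ha : 7 ≤ a) {x : K} {r : ℝ}
    (hx : x ^ 3 - a * x ^ 2 - (a + 3) * x - 1 = 0) (hadj : IntermediateField.adjoin ℚ {x} = ⊤)
    (hclosure : Algebra.adjoin ℤ {x} = integralClosure ℤ K)
    (h : r ^ 3 - (a : ℝ) * r ^ 2 - (a + 3) * r - 1 = 0) (hr1 : (a : ℝ) + 1 < r)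
    (hr2 : r < (a : ℝ) + 2) :
    regulator K = Real.log r ^ 2 - Real.log r * Real.log (1 + r) + Real.log (1 + r) ^ 2 := by
  have ha' : (7 : ℝ) ≤ a := by exact_mod_cast ha
  have hr : 0 < r := by linarith
  obtain ⟨W, hmult, hW⟩ := exists_infinitePlace_equiv hx hadj h (by linarith)
  have hrank : rank K = 2 := by
    rw [rank, ← Fintype.card_congr W, Fintype.card_fin]
  set A := Real.log r with hA
  set B := Real.log (1 + r) with hB
  have hA0 : 0 < A := Real.log_pos (by linarith)
  have hAB : A ≤ B := Real.log_le_log hr (by linarith)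
  have hBA : B ≤ 2 * A := by
    have : B ≤ Real.log (r ^ 2) := Real.log_le_log (by linarith) (by nlinarith)
    rw [Real.log_pow] at this
    exact_mod_cast this
  obtain ⟨X, hXx⟩ : ∃ X : 𝓞 K, algebraMap (𝓞 K) K X = x :=
    ⟨⟨x, hclosure ▸ Algebra.self_mem_adjoin_singleton ℤ x⟩, rfl⟩
  have hX : X ^ 3 - a * X ^ 2 - (a + 3) * X - 1 = 0 := by
    apply RingOfIntegers.coe_injective
    simp only [map_sub, map_mul, map_pow, map_add, map_intCast, map_one, map_zero, map_ofNat,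
      hXx]
    exact hx
  let ε₁ : (𝓞 K)ˣ := Units.mkOfMulEqOne X (X ^ 2 - a * X - (a + 3)) (by linear_combination hX)
  let ε₂ : (𝓞 K)ˣ := Units.mkOfMulEqOne (1 + X) (-(X ^ 2 - (a + 1) * X - 2))
    (by linear_combination -hX)
  have hε₁ : algebraMap (𝓞 K) K (ε₁ : 𝓞 K) = x := hXx
  have hε₂ : algebraMap (𝓞 K) K (ε₂ : 𝓞 K) = 1 + x := by
    change algebraMap (𝓞 K) K (1 + X) = 1 + x
    rw [map_add, map_one, hXx]
  have hWx := fun i ↦ hW i 0 1 0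
  have hWx' := fun i ↦ hW i 1 1 0
  simp only [Int.cast_zero, Int.cast_one, one_mul, zero_mul, zero_add, add_zero] at hWx hWx'
  have a0 : Real.log (W 0 (ε₁ : K)) = A := by
    rw [hε₁, hWx, Real.log_abs]; rfl
  have a1 : Real.log (W 1 (ε₁ : K)) = B - A := by
    rw [hε₁, hWx, Real.log_abs]
    change Real.log (-(1 + r) / r) = B - A
    rw [neg_div, Real.log_neg_eq_log, Real.log_div (by positivity) (by positivity)]
  have b0 : Real.log (W 0 (ε₂ : K)) = B := by
    rw [hε₂, hWx', Real.log_abs]; rfl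
  have b1 : Real.log (W 1 (ε₂ : K)) = -A := by
    rw [hε₂, hWx', Real.log_abs]
    change Real.log (1 + -(1 + r) / r) = -A
    rw [show 1 + -(1 + r) / r = -r⁻¹ by field_simp; ring, Real.log_neg_eq_log, Real.log_inv]
  have hsum : ∀ v : (𝓞 K)ˣ,
      Real.log (W 0 (v : K)) + Real.log (W 1 (v : K)) + Real.log (W 2 (v : K)) = 0 := by
    intro v
    have := sum_mult_mul_log v
    rw [← Equiv.sum_comp W, Fin.sum_univ_three] at this
    simpa [hmult] using this
  have a2 : Real.log (W 2 (ε₁ : K)) = -B := by linarith [hsum ε₁]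
  have b2 : Real.log (W 2 (ε₂ : K)) = A - B := by linarith [hsum ε₂]
  have hreg := regOfFamily_eq_of_rank_eq_two W hmult hrank ![ε₁, ε₂]
  set u : Fin (rank K) → (𝓞 K)ˣ := fun i ↦ ![ε₁, ε₂] (finCongr hrank i) with hu
  have hmem₁ : ε₁ ∈ Subgroup.closure (Set.range u) :=
    Subgroup.subset_closure ⟨(finCongr hrank).symm 0, by simp [hu]⟩
  have hmem₂ : ε₂ ∈ Subgroup.closure (Set.range u) :=
    Subgroup.subset_closure ⟨(finCongr hrank).symm 1, by simp [hu]⟩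
  have htop : Subgroup.closure (Set.range u) ⊔ torsion K = ⊤ := by
    rw [eq_top_iff]
    intro v _
    obtain ⟨m, n, hmn⟩ := exists_int_sub_close hA0 hAB hBA (hsum v)
    set g : (𝓞 K)ˣ := ε₁ ^ m * ε₂ ^ n with hg
    have hlog : ∀ i, Real.log (W i ((v * g⁻¹ : (𝓞 K)ˣ) : K)) = Real.log (W i (v : K)) -
        (m * Real.log (W i (ε₁ : K)) + n * Real.log (W i (ε₂ : K))) := by
      intro i
      have h₀ : ∀ u : (𝓞 K)ˣ, W i (u : K) ≠ 0 := fun u ↦ (pos_at_place u _).ne'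
      rw [← zpow_neg_one, hg, coe_mul, coe_zpow, coe_mul, coe_zpow, coe_zpow]
      simp only [map_mul, map_zpow₀]
      rw [Real.log_mul (h₀ _) (zpow_ne_zero _ (mul_ne_zero (zpow_ne_zero _ (h₀ _))
        (zpow_ne_zero _ (h₀ _)))), Real.log_zpow, Real.log_mul (zpow_ne_zero _ (h₀ _))
        (zpow_ne_zero _ (h₀ _)), Real.log_zpow, Real.log_zpow]
      push_cast
      ring
    have htors : v * g⁻¹ ∈ torsion K := by
      set y := v * g⁻¹
      obtain ⟨h01, h12, h20⟩ := hmn (Real.log (W 0 (y : K))) (Real.log (W 1 (y : K)))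
        (Real.log (W 2 (y : K))) (by rw [hlog 0, a0, b0])
        (by rw [hlog 1, a1, b1]; ring) (by rw [hlog 2, a2, b2]; ring)
      have hpos : ∀ i, 0 < W i (y : K) := fun i ↦ pos_at_place y _
      obtain ⟨p, q, s, hpqs⟩ := exists_int_coeff_of_mem_adjoin hx
        (hclosure.symm ▸ (y : 𝓞 K).2 : (y : K) ∈ Algebra.adjoin ℤ {x})
      have hWy : ∀ i, W i (y : K) = |(p : ℝ) + q * (![r, -(1 + r) / r, -1 / (1 + r)] i) +
          s * (![r, -(1 + r) / r, -1 / (1 + r)] i) ^ 2| := fun i ↦ by rw [hpqs]; exact hW i p q s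
      have hprod : W 0 (y : K) * W 1 (y : K) * W 2 (y : K) = 1 := by
        rw [← Real.exp_zero, ← hsum y, Real.exp_add, Real.exp_add, Real.exp_log (hpos 0),
          Real.exp_log (hpos 1), Real.exp_log (hpos 2)]
      have hC : Real.exp (3 / 2 * B) ^ 2 ≤ (1 + r) ^ 3 := by
        have hBexp : Real.exp B = 1 + r := Real.exp_log (by linarith)
        rw [← hBexp, ← Real.exp_nat_mul, ← Real.exp_nat_mul]
        apply le_of_eq
        congr 1
        push_cast
        ring
      have k01 := le_exp_mul_of_abs_log_sub_le (hpos 0) (hpos 1) h01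
      have k12 := le_exp_mul_of_abs_log_sub_le (hpos 1) (hpos 2) h12
      have k20 := le_exp_mul_of_abs_log_sub_le (hpos 2) (hpos 0) h20
      simp only [hWy] at k01 k12 k20 hprod
      obtain ⟨rfl, rfl⟩ := simplestCubic_eq_zero_of_conjugates_close ha h hr1 hr2 hC p q s
        rfl rfl rfl (by rw [abs_mul, abs_mul]; exact hprod)
        k01.1 k01.2 k12.1 k12.2 k20.1 k20.2
      simp only [Int.cast_zero, zero_mul, add_zero] at hprod hWy
      have hp : |(p : ℝ)| = 1 :=
        (pow_eq_one_iff_of_nonneg (abs_nonneg _) three_ne_zero).mp (by linear_combination hprod)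
      rw [mem_torsion]
      intro w
      obtain ⟨i, rfl⟩ := W.surjective w
      rw [hWy, hp]
    have hgm : g ∈ Subgroup.closure (Set.range u) :=
      mul_mem (zpow_mem hmem₁ m) (zpow_mem hmem₂ n)
    rw [← inv_mul_cancel_right v g]
    exact mul_mem (Subgroup.mem_sup_right htors) (Subgroup.mem_sup_left hgm)
  have hindex := regOfFamily_div_regulator u
  rw [htop, Subgroup.index_top, Nat.cast_one, div_eq_one_iff_eq (regulator_ne_zero K)] at hindex
  rw [← hindex, hreg]
  simp only [Matrix.cons_val_zero, Matrix.cons_val_one, a0, a1, b0, b1]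
  rw [abs_of_nonpos
    (by nlinarith [mul_nonneg (hA0.le.trans hAB) (sub_nonneg.mpr hAB), sq_nonneg A])]
  ring

end Units

theorem stmt_5 :
    ∀ (a : ℤ), 7 ≤ a →
    ∀ (K : Type) [Field K] [NumberField K] (σ : K →+* ℝ) (ρK : K),
      σ ρK = simplestCubicRoot a →
      IntermediateField.adjoin ℚ {ρK} = ⊤ →
      Algebra.adjoin ℤ {ρK} = integralClosure ℤ K →
      (Real.log a) ^ 2 ≤ NumberField.Units.regulator K ∧
        NumberField.Units.regulator K ≤ (3 / 2) * (Real.log a) ^ 2 := by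
  intro a ha K _ _ σ ρK hσ hadj hclosure
  obtain ⟨h, h1, h2⟩ := simplestCubicRoot_spec ha
  have hρ : ρK ^ 3 - a * ρK ^ 2 - (a + 3) * ρK - 1 = 0 := by
    apply σ.injective
    simp only [map_sub, map_mul, map_pow, map_add, map_intCast, map_one, map_zero, map_ofNat,
      hσ]
    exact h
  rw [regulator_simplestCubic ha hρ hadj hclosure h h1 h2]
  exact log_estimates (by exact_mod_cast ha) h1 h2
end

section
/- For every real r > 0 there exists a constant C_r > 0 such that for every integer a ≥ 8 and every real number x with 1 ≤ x ≤ a^r, the number of triples of integers (m, n, o) with n ≥ 1, 2m > n, 2o > n and Nm(m + n·ρ + o·ρ²) ≤ x is at most C_r·(log a)²·x/a². -/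
open NumberField

open Polynomial in
/-- The simplest cubic polynomial `X³ - aX² - (a+3)X - 1` over `ℤ`. -/
noncomputable def simplestCubic (a : ℤ) : ℤ[X] :=
  X ^ 3 - C a * X ^ 2 - C (a + 3) * X - 1

theorem natDegree_simplestCubic (a : ℤ) : (simplestCubic a).natDegree = 3 := by
  unfold simplestCubic
  compute_degree!

theorem monic_simplestCubic (a : ℤ) : (simplestCubic a).Monic := by
  unfold simplestCubic
  monicity!

theorem irreducible_simplestCubic {a : ℤ} (ha : 8 ≤ a) : Irreducible (simplestCubic a) := by
  rw [(monic_simplestCubic a).irreducible_iff_roots_eq_zero_of_degree_le_three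
    (by rw [natDegree_simplestCubic]; norm_num) (natDegree_simplestCubic a).le]
  refine Multiset.eq_zero_of_forall_notMem fun z hz => ?_
  have hz' : z ^ 3 - a * z ^ 2 - (a + 3) * z - 1 = 0 := by
    simpa [simplestCubic] using Polynomial.isRoot_of_mem_roots hz
  have hunit : IsUnit z := .of_mul_eq_one (z ^ 2 - a * z - (a + 3)) (by linear_combination hz')
  rcases Int.isUnit_iff.mp hunit with rfl | rfl <;> linarith

theorem simplestCubicRoot_isRoot {a : ℤ} (ha : 8 ≤ a) :
    simplestCubicRoot a ^ 3 - (a : ℝ) * simplestCubicRoot a ^ 2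
      - ((a : ℝ) + 3) * simplestCubicRoot a - 1 = 0 := by
  have ha' : (8 : ℝ) ≤ a := by exact_mod_cast ha
  let f : ℝ → ℝ := fun x => x ^ 3 - (a : ℝ) * x ^ 2 - ((a : ℝ) + 3) * x - 1
  have hf : Continuous f := by fun_prop
  have hne : {x : ℝ | f x = 0}.Nonempty := by
    obtain ⟨x, -, hx⟩ := intermediate_value_Icc (by linarith : (0 : ℝ) ≤ a + 2) hf.continuousOn
      (show (0 : ℝ) ∈ Set.Icc (f 0) (f (a + 2)) by
        constructor
        · norm_num [f]
        · simp only [f]; nlinarith)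
    exact ⟨x, hx⟩
  have hbdd : BddAbove {x : ℝ | f x = 0} := by
    refine ⟨a + 2, fun x (hx : f x = 0) => ?_⟩
    by_contra! hlt
    have h1 : 0 < (x - a - 2) * x ^ 2 := by
      have : 0 < x := by linarith
      have : 0 < x - a - 2 := by linarith
      positivity
    have h2 : 0 < x * (2 * x - a - 3) - 1 := by nlinarith
    simp only [f] at hx
    nlinarith
  exact (isClosed_eq hf continuous_const).csSup_mem hne hbdd

/-- The norm of `m + nρ + oρ²`, for `ρ` a root of the simplest cubic polynomial, as the
determinant of multiplication in the basis `1, ρ, ρ²`. -/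
theorem norm_eq_det_of_simplestCubic {K : Type*} [Field K] [NumberField K] {a : ℤ} (ha : 8 ≤ a)
    {ρ : K} (hρ : ρ ^ 3 - (a : K) * ρ ^ 2 - ((a : K) + 3) * ρ - 1 = 0)
    (htop : IntermediateField.adjoin ℚ {ρ} = ⊤) (m n o : ℤ) :
    Algebra.norm ℚ ((m : K) + (n : K) * ρ + (o : K) * ρ ^ 2) =
      Matrix.det !![(m : ℚ), o, n + a * o;
        n, m + (a + 3) * o, o + (a + 3) * (n + a * o);
        o, n + a * o, m + (a + 3) * o + a * (n + a * o)] := by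
  have hmin : (simplestCubic a).map (algebraMap ℤ ℚ) = minpoly ℚ ρ := by
    refine minpoly.eq_of_irreducible_of_monic ?_ ?_ ((monic_simplestCubic a).map _)
    · exact ((monic_simplestCubic a).irreducible_iff_irreducible_map_fraction_map).mp
        (irreducible_simplestCubic ha)
    · simpa [simplestCubic, map_ofNat] using hρ
  have hdeg : (minpoly ℚ ρ).natDegree = 3 := by
    rw [← hmin, (monic_simplestCubic a).natDegree_map, natDegree_simplestCubic]
  have hli : LinearIndependent ℚ fun i : Fin 3 => ρ ^ (i : ℕ) := hdeg ▸ linearIndependent_pow ρ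
  have hfin : Module.finrank ℚ K = 3 :=
    hdeg ▸ ((Field.primitive_element_iff_minpoly_natDegree_eq ℚ ρ).mp htop).symm
  let b := basisOfLinearIndependentOfCardEqFinrank hli (by simp [hfin])
  have hb : ∀ i, b i = ρ ^ (i : ℕ) := fun i => by simp [b]
  rw [Algebra.norm_eq_matrix_det b]
  congr 1
  have key : ∀ (x : K) (j : Fin 3) (c : Fin 3 → ℚ), x * ρ ^ (j : ℕ) = ∑ i, c i • ρ ^ (i : ℕ) →
      ∀ i, Algebra.leftMulMatrix b x i j = c i := by
    intro x j c h i
    rw [Algebra.leftMulMatrix_eq_repr_mul, hb, h]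
    simp_rw [← hb]
    rw [b.repr_sum_self]
  ext i j
  fin_cases j
  · rw [key _ _ ![m, n, o]]
    · fin_cases i <;> rfl
    · simp [Fin.sum_univ_three, Algebra.smul_def]
  · rw [key _ _ ![o, m + (a + 3) * o, n + a * o]]
    · fin_cases i <;> rfl
    · simp [Fin.sum_univ_three, Algebra.smul_def]
      linear_combination (o : K) * hρ
  · rw [key _ _ ![n + a * o, o + (a + 3) * (n + a * o), m + (a + 3) * o + a * (n + a * o)]]
    · fin_cases i <;> rfl
    · simp [Fin.sum_univ_three, Algebra.smul_def]
      linear_combination ((o : K) * ρ + (n + a * o)) * hρ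

theorem mul_le_det_of_simplestCubic {a m n o : ℝ} (ha : 8 ≤ a) (hn : 1 ≤ n) (hm : n < 2 * m)
    (ho : n < 2 * o) :
    a ^ 2 * (m * o * (m + o - n)) ≤
      Matrix.det !![m, o, n + a * o;
        n, m + (a + 3) * o, o + (a + 3) * (n + a * o);
        o, n + a * o, m + (a + 3) * o + a * (n + a * o)] := by
  obtain ⟨p, rfl⟩ : ∃ p, m = (n + p) / 2 := ⟨2 * m - n, by ring⟩
  obtain ⟨q, rfl⟩ : ∃ q, o = (n + q) / 2 := ⟨2 * o - n, by ring⟩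
  obtain ⟨b, rfl⟩ : ∃ b, a = b + 8 := ⟨a - 8, by ring⟩
  have hp : 0 < p := by linarith
  have hq : 0 < q := by linarith
  have hb : 0 ≤ b := by linarith
  have hn' : 0 < n := by linarith
  rw [← sub_nonneg, Matrix.det_fin_three]
  simp only [Matrix.of_apply, Matrix.cons_val', Matrix.cons_val_zero, Matrix.cons_val_one,
    Matrix.cons_val, Matrix.cons_val_fin_one]
  ring_nf
  positivity

/-- The summatory function of the three-fold divisor function is `O(y (1 + log y)²)`. -/
theorem ncard_prod_three_le {y : ℝ} (hy : 0 ≤ y) :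
    {t : ℕ × ℕ × ℕ | 1 ≤ t.1 ∧ 1 ≤ t.2.1 ∧ 1 ≤ t.2.2 ∧ (t.1 : ℝ) * t.2.1 * t.2.2 ≤ y}.Finite ∧
    ({t : ℕ × ℕ × ℕ | 1 ≤ t.1 ∧ 1 ≤ t.2.1 ∧ 1 ≤ t.2.2 ∧
      (t.1 : ℝ) * t.2.1 * t.2.2 ≤ y}.ncard : ℝ) ≤ y * (harmonic ⌊y⌋₊ : ℝ) ^ 2 := by
  set N := ⌊y⌋₊ with hN
  set s : Finset (ℕ × ℕ × ℕ) := (Finset.Icc 1 N).biUnion fun i => (Finset.Icc 1 N).biUnion fun j =>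
    (Finset.Icc 1 ⌊y / (i * j)⌋₊).image fun k => (i, j, k) with hs
  have hsub : {t : ℕ × ℕ × ℕ | 1 ≤ t.1 ∧ 1 ≤ t.2.1 ∧ 1 ≤ t.2.2 ∧
      (t.1 : ℝ) * t.2.1 * t.2.2 ≤ y} ⊆ (s : Set (ℕ × ℕ × ℕ)) := by
    rintro ⟨i, j, k⟩ ⟨hi, hj, hk, h⟩
    dsimp only at hi hj hk h
    have hi' : (1 : ℝ) ≤ i := by exact_mod_cast hi
    have hj' : (1 : ℝ) ≤ j := by exact_mod_cast hj
    have hk' : (1 : ℝ) ≤ k := by exact_mod_cast hk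
    have hij : (1 : ℝ) ≤ i * j := one_le_mul_of_one_le_of_one_le hi' hj'
    have hle : (i : ℝ) * j ≤ y := (le_mul_of_one_le_right (by positivity) hk').trans h
    simp only [hs, Finset.coe_biUnion, Finset.coe_image, Set.mem_iUnion, Finset.mem_coe,
      Finset.mem_Icc, Set.mem_image, exists_prop]
    refine ⟨i, ⟨hi, Nat.le_floor ?_⟩, j, ⟨hj, Nat.le_floor ?_⟩, k, ⟨hk, Nat.le_floor ?_⟩, rfl⟩
    · exact (le_mul_of_one_le_right (by positivity) hj').trans hle
    · exact (le_mul_of_one_le_left (by positivity) hi').trans hle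
    · rw [le_div_iff₀ (by positivity)]
      linarith
  refine ⟨s.finite_toSet.subset hsub, ?_⟩
  have hcard : (s.card : ℝ) ≤ ∑ i ∈ Finset.Icc 1 N, ∑ j ∈ Finset.Icc 1 N, y / (i * j) := by
    have h1 : s.card ≤ ∑ i ∈ Finset.Icc 1 N, ∑ j ∈ Finset.Icc 1 N, ⌊y / (i * j)⌋₊ :=
      Finset.card_biUnion_le.trans <| Finset.sum_le_sum fun i _ =>
        Finset.card_biUnion_le.trans <| Finset.sum_le_sum fun j _ =>
          Finset.card_image_le.trans (by simp)
    refine (Nat.cast_le.mpr h1).trans ?_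
    push_cast
    gcongr
    exact Nat.floor_le (by positivity)
  calc _ ≤ (s.card : ℝ) := by
        rw [← Set.ncard_coe_finset]
        exact_mod_cast Set.ncard_le_ncard hsub s.finite_toSet
    _ ≤ _ := hcard
    _ = y * (harmonic N : ℝ) ^ 2 := by
        rw [harmonic_eq_sum_Icc]
        push_cast
        rw [sq, Finset.sum_mul_sum, Finset.mul_sum]
        refine Finset.sum_congr rfl fun i _ => ?_
        rw [Finset.mul_sum]
        refine Finset.sum_congr rfl fun j _ => ?_
        rw [div_eq_mul_inv, mul_inv]

theorem stmt_7 :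
    ∀ r : ℝ, 0 < r →
    ∃ C : ℝ, 0 < C ∧
      ∀ (a : ℤ), 8 ≤ a →
      ∀ (K : Type) [Field K] [NumberField K] (σ : K →+* ℝ) (ρK : K),
        σ ρK = simplestCubicRoot a →
        IntermediateField.adjoin ℚ {ρK} = ⊤ →
        ∀ x : ℝ, 1 ≤ x → x ≤ (a : ℝ) ^ r →
          (Set.ncard {t : ℤ × ℤ × ℤ | 1 ≤ t.2.1 ∧ t.2.1 < 2 * t.1 ∧ t.2.1 < 2 * t.2.2 ∧
              ((Algebra.norm ℚ ((t.1 : K) + (t.2.1 : K) * ρK + (t.2.2 : K) * ρK ^ 2) : ℚ) : ℝ)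
                ≤ x} : ℝ) ≤
            C * (Real.log a) ^ 2 * x / (a : ℝ) ^ 2 := by
  intro r hr
  refine ⟨(1 + r) ^ 2, by positivity, ?_⟩
  intro a ha K _ _ σ ρ hσ htop x hx1 hxr
  have ha' : (8 : ℝ) ≤ a := by exact_mod_cast ha
  have ha0 : (0 : ℝ) < a := by linarith
  have hρ : ρ ^ 3 - (a : K) * ρ ^ 2 - ((a : K) + 3) * ρ - 1 = 0 := by
    apply σ.injective
    simpa [hσ, map_ofNat] using simplestCubicRoot_isRoot ha
  set y : ℝ := x / (a : ℝ) ^ 2 with hy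
  have hy0 : 0 ≤ y := by positivity
  obtain ⟨hfin, hcount⟩ := ncard_prod_three_le hy0
  have hinj := Set.ncard_le_ncard_of_injOn
    (s := {t : ℤ × ℤ × ℤ | 1 ≤ t.2.1 ∧ t.2.1 < 2 * t.1 ∧ t.2.1 < 2 * t.2.2 ∧
      ((Algebra.norm ℚ ((t.1 : K) + (t.2.1 : K) * ρ + (t.2.2 : K) * ρ ^ 2) : ℚ) : ℝ) ≤ x})
    (t := {t : ℕ × ℕ × ℕ | 1 ≤ t.1 ∧ 1 ≤ t.2.1 ∧ 1 ≤ t.2.2 ∧ (t.1 : ℝ) * t.2.1 * t.2.2 ≤ y})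
    (fun t => (t.1.toNat, t.2.2.toNat, (t.1 + t.2.2 - t.2.1).toNat)) (by
      rintro ⟨m, n, o⟩ ⟨hn, hm, ho, hnorm⟩
      dsimp only at hn hm ho hnorm
      refine ⟨by dsimp only; omega, by dsimp only; omega, by dsimp only; omega, ?_⟩
      have hcast : ∀ z : ℤ, 0 ≤ z → ((z.toNat : ℕ) : ℝ) = z := fun z hz => by
        exact_mod_cast Int.toNat_of_nonneg hz
      dsimp only
      rw [hcast m (by omega), hcast o (by omega), hcast _ (by omega : 0 ≤ m + o - n), hy,
        le_div_iff₀ (by positivity)]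
      have hdet := mul_le_det_of_simplestCubic (m := m) (n := n) (o := o) ha'
        (by exact_mod_cast hn) (by exact_mod_cast hm) (by exact_mod_cast ho)
      rw [norm_eq_det_of_simplestCubic ha hρ htop] at hnorm
      have hcomm := hdet.trans (le_of_eq_of_le ?_ hnorm)
      · push_cast
        linarith
      · simp [Matrix.det_fin_three]) (by
      rintro ⟨m, n, o⟩ ⟨hn, hm, ho, -⟩ ⟨m', n', o'⟩ ⟨hn', hm', ho', -⟩ h
      simp only [Prod.mk.injEq] at h hn hm ho hn' hm' ho' ⊢
      omega) hfin
  have hlog : 1 ≤ Real.log a := by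
    rw [Real.le_log_iff_exp_le ha0]
    linarith [Real.exp_one_lt_d9]
  have hharm : (harmonic ⌊y⌋₊ : ℝ) ≤ (1 + r) * Real.log a := by
    rcases lt_or_ge y 1 with h | h
    · rw [Nat.floor_eq_zero.mpr h]
      simp only [harmonic_zero, Rat.cast_zero]
      positivity
    · have hyx : y ≤ (a : ℝ) ^ r :=
        (div_le_self (by linarith) (by nlinarith)).trans hxr
      have := Real.log_le_log (by linarith) hyx
      rw [Real.log_rpow ha0] at this
      linarith [harmonic_floor_le_one_add_log y h]
  have hharm0 : (0 : ℝ) ≤ harmonic ⌊y⌋₊ := by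
    rw [harmonic]
    push_cast
    positivity
  calc _ ≤ y * (harmonic ⌊y⌋₊ : ℝ) ^ 2 := (Nat.cast_le.mpr hinj).trans hcount
    _ ≤ y * ((1 + r) * Real.log a) ^ 2 := by gcongr
    _ = _ := by rw [hy]; ring
end
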